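/- If f(p) = D(a_0,...,a_n;p) is an optimal penalty function, then the set of absolute maxima M(f) intersects both [0, min_i a_i) and (max_i a_i, 1]. -/

import Mathlib

open Finset

noncomputable def penalty (n : ℕ) (a : Fin (n+1) → ℝ) (p : ℝ) : ℝ :=
  ∑ k : Fin (n+1), (n.choose (k:ℕ) : ℝ) * p ^ (k:ℕ) * (1 - p) ^ (n - (k:ℕ)) * |p - a k|

def IsOptimal (n : ℕ) (a : Fin (n+1) → ℝ) : Prop :=
  (∀ k, a k ∈ Set.Icc (0:ℝ) 1) ∧
  ∀ b : Fin (n+1) → ℝ, (∀ k, b k ∈ Set.Icc (0:ℝ) 1) →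
    sSup ((fun p => penalty n a p) '' Set.Icc (0:ℝ) 1) ≤
      sSup ((fun p => penalty n b p) '' Set.Icc (0:ℝ) 1)

noncomputable def wt (n k : ℕ) (p : ℝ) : ℝ := (n.choose k : ℝ) * p ^ k * (1 - p) ^ (n - k)

lemma penalty_eq (n : ℕ) (a : Fin (n+1) → ℝ) (p : ℝ) :
    penalty n a p = ∑ k : Fin (n+1), wt n k p * |p - a k| := rfl

lemma wt_nonneg (n k : ℕ) {p : ℝ} (h0 : 0 ≤ p) (h1 : p ≤ 1) : 0 ≤ wt n k p := by
  have : 0 ≤ 1 - p := by linarith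
  unfold wt; positivity

lemma wt_pos (n k : ℕ) (hk : k ≤ n) {p : ℝ} (h0 : 0 < p) (h1 : p < 1) : 0 < wt n k p := by
  have : 0 < 1 - p := by linarith
  have := Nat.choose_pos hk
  unfold wt; positivity

lemma wt_cont (n k : ℕ) : Continuous (wt n k) := by unfold wt; fun_prop

lemma wt_sum (n : ℕ) (p : ℝ) : ∑ k : Fin (n+1), wt n k p = 1 := by
  have h := add_pow p (1 - p) n
  rw [Finset.sum_range] at h
  have h2 : p + (1 - p) = 1 := by ring
  rw [h2, one_pow] at h
  rw [h]
  refine Finset.sum_congr rfl fun i _ => ?_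
  unfold wt; ring

lemma wt_le_one (n : ℕ) (k : Fin (n+1)) {p : ℝ} (h0 : 0 ≤ p) (h1 : p ≤ 1) : wt n k p ≤ 1 := by
  rw [← wt_sum n p]
  exact Finset.single_le_sum (f := fun k : Fin (n+1) => wt n k p)
    (fun i _ => wt_nonneg n i h0 h1) (Finset.mem_univ k)

lemma wt_le (n k : ℕ) (hk : k ≠ 0) {p : ℝ} (h0 : 0 ≤ p) (h1 : p ≤ 1) :
    wt n k p ≤ (n.choose k : ℝ) * p := by
  have h2 : p ^ k ≤ p := pow_le_of_le_one h0 h1 hk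
  have h3 : (1 - p) ^ (n - k) ≤ 1 := pow_le_one₀ (by linarith) (by linarith)
  have h4 : 0 ≤ (1 - p) ^ (n - k) := pow_nonneg (by linarith) _
  unfold wt
  calc (n.choose k : ℝ) * p ^ k * (1 - p) ^ (n - k) ≤ (n.choose k : ℝ) * p ^ k * 1 := by
        gcongr
    _ ≤ _ := by rw [mul_one]; gcongr

def pert {n : ℕ} (a : Fin (n+1) → ℝ) (j : Fin (n+1)) (x : ℝ) : Fin (n+1) → ℝ :=
  fun i => a i + x * (if i = j then 1 else 0)

lemma pert_self {n : ℕ} (a : Fin (n+1) → ℝ) (j : Fin (n+1)) (x : ℝ) : pert a j x j = a j + x := by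
  simp [pert]

lemma pert_ne {n : ℕ} (a : Fin (n+1) → ℝ) {j i : Fin (n+1)} (h : i ≠ j) (x : ℝ) :
    pert a j x i = a i := by
  simp [pert, h]

lemma penalty_pert {n : ℕ} (a : Fin (n+1) → ℝ) (j : Fin (n+1)) (x p : ℝ) :
    penalty n (pert a j x) p = penalty n a p + wt n j p * (|p - a j - x| - |p - a j|) := by
  have : penalty n (pert a j x) p - penalty n a p = wt n j p * (|p - a j - x| - |p - a j|) := by
    rw [penalty_eq, penalty_eq, ← Finset.sum_sub_distrib, Finset.sum_eq_single j]
    · rw [pert_self, ← sub_sub]; ring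
    · intro b _ hb
      rw [pert_ne _ hb]; ring
    · simp
  linarith

lemma penalty_zero {n : ℕ} (a : Fin (n+1) → ℝ) : penalty n a 0 = a 0 ∨ penalty n a 0 = - a 0 := by
  have : penalty n a 0 = |a 0| := by
    rw [penalty_eq, Finset.sum_eq_single 0]
    · simp [wt]
    · intro b _ hb
      have : (b : ℕ) ≠ 0 := fun h => hb (Fin.ext h)
      simp [wt, this]
    · simp
  rw [this]; exact abs_choice _

lemma penalty_one {n : ℕ} (a : Fin (n+1) → ℝ) : penalty n a 1 = |1 - a (Fin.last n)| := by
  rw [penalty_eq, Finset.sum_eq_single (Fin.last n)]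
  · simp [wt]
  · intro b _ hb
    have h : (b : ℕ) ≠ n := fun h => hb (Fin.ext h)
    have : n - (b : ℕ) ≠ 0 := by have := b.2; omega
    simp [wt, this]
  · simp

lemma penalty_cont (n : ℕ) (a : Fin (n+1) → ℝ) : Continuous (penalty n a) := by
  unfold penalty; fun_prop

lemma bdd (n : ℕ) (a : Fin (n+1) → ℝ) :
    BddAbove ((fun p => penalty n a p) '' Set.Icc (0:ℝ) 1) :=
  (isCompact_Icc.image (penalty_cont n a)).bddAbove

lemma le_S (n : ℕ) (a : Fin (n+1) → ℝ) {p : ℝ} (hp : p ∈ Set.Icc (0:ℝ) 1) :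
    penalty n a p ≤ sSup ((fun p => penalty n a p) '' Set.Icc (0:ℝ) 1) :=
  le_csSup (bdd n a) ⟨p, hp, rfl⟩

lemma exists_S (n : ℕ) (a : Fin (n+1) → ℝ) : ∃ p ∈ Set.Icc (0:ℝ) 1,
    penalty n a p = sSup ((fun p => penalty n a p) '' Set.Icc (0:ℝ) 1) := by
  have := (isCompact_Icc.image (penalty_cont n a)).sSup_mem
    (Set.Nonempty.image _ (Set.nonempty_Icc.2 (zero_le_one' ℝ)))
  exact this

lemma opt_all {n : ℕ} {a : Fin (n+1) → ℝ} (ha : IsOptimal n a) (b : Fin (n+1) → ℝ) :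
    ∃ p ∈ Set.Icc (0:ℝ) 1,
      sSup ((fun p => penalty n a p) '' Set.Icc (0:ℝ) 1) ≤ penalty n b p := by
  obtain ⟨p, hp, h⟩ := exists_S n (fun k => max 0 (min 1 (b k)))
  refine ⟨p, hp, (ha.2 (fun k => max 0 (min 1 (b k))) fun k => ⟨le_max_left _ _, max_le zero_le_one (min_le_left _ _)⟩).trans ?_⟩
  rw [← h, penalty_eq, penalty_eq]
  refine Finset.sum_le_sum fun k _ => mul_le_mul_of_nonneg_left ?_ (wt_nonneg _ _ hp.1 hp.2)
  obtain ⟨h0, h1⟩ := hp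
  rcases max_cases 0 (min 1 (b k)) with h | h <;> rcases min_cases 1 (b k) with h' | h' <;>
  rcases abs_cases (p - max 0 (min 1 (b k))) with h2 | h2 <;>
  rcases abs_cases (p - b k) with h3 | h3 <;> linarith

lemma kink {n : ℕ} {a : Fin (n+1) → ℝ} (k : Fin (n+1)) (hk : ∀ i, a k ≤ a i)
    (h0 : 0 < a k) (h1 : a k < 1)
    (hmax : ∀ p ∈ Set.Icc (0:ℝ) 1, penalty n a p ≤ penalty n a (a k)) : False := by
  set m := a k with hm
  let h : ℝ → ℝ := fun p => ∑ i : Fin (n+1), wt n i p * (a i - p)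
  have hd : Differentiable ℝ h := by
    simp only [h]; unfold wt; fun_prop
  have hmm : penalty n a m = h m := by
    rw [penalty_eq]
    refine Finset.sum_congr rfl fun i _ => ?_
    rw [abs_sub_comm, abs_of_nonneg (by linarith [hk i])]
  have key : ∀ c : ℝ, 0 ≤ c → c ≤ 2 → IsLocalMax (fun p => h p + c * (wt n k p * (p - m))) m := by
    intro c hc0 hc2
    filter_upwards [Icc_mem_nhds h0 h1] with p hp
    have e1 := hmax p hp
    rw [hmm] at e1
    simp only [sub_self, mul_zero, add_zero]
    refine le_trans ?_ e1
    rw [penalty_eq]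
    have : ∑ i : Fin (n+1), wt n i p * (a i - p)
        + ∑ i : Fin (n+1), (if i = k then c * (wt n k p * (p - m)) else 0)
        ≤ ∑ k : Fin (n+1), wt n k p * |p - a k| := by
      rw [← Finset.sum_add_distrib]
      refine Finset.sum_le_sum fun i _ => ?_
      have hw := wt_nonneg n i hp.1 hp.2
      split_ifs with hi
      · subst hi
        have : (a i - p) + c * (p - m) ≤ |p - a i| := by
          rw [← hm]
          rcases abs_cases (p - m) with h | h <;> nlinarith
        nlinarith
      · rw [add_zero]
        refine mul_le_mul_of_nonneg_left ?_ hw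
        rw [abs_sub_comm]; exact le_abs_self _
    simpa using this
  have d1 : HasDerivAt h (deriv h m) m := (hd m).hasDerivAt
  have hwd : DifferentiableAt ℝ (wt n k) m := by unfold wt; fun_prop
  have d2 := hwd.hasDerivAt.mul ((hasDerivAt_id m).sub_const m)
  have z0 := (key 0 le_rfl (by norm_num)).hasDerivAt_eq_zero (d1.add (d2.const_mul 0))
  have z1 := (key 1 (by norm_num) (by norm_num)).hasDerivAt_eq_zero (d1.add (d2.const_mul 1))
  simp at z0 z1
  have := wt_pos n k (by have := k.2; omega) h0 h1
  rw [z0] at z1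
  linarith

lemma half (n : ℕ) (hn : 0 < n) (a : Fin (n+1) → ℝ) (ha : IsOptimal n a) :
    ∃ x, 0 ≤ x ∧ x < (⨅ i, a i) ∧
      penalty n a x = sSup ((fun p => penalty n a p) '' Set.Icc (0:ℝ) 1) := by
  obtain ⟨k, hk⟩ := Finite.exists_min a
  have hinf : (⨅ i, a i) = a k :=
    le_antisymm (ciInf_le (Set.finite_range a).bddBelow k) (le_ciInf hk)
  rw [hinf]
  by_contra! hcon
  have hopt := opt_all ha
  have hle : ∀ p ∈ Set.Icc (0:ℝ) 1, _ := fun p hp => le_S n a hp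
  set S := sSup ((fun p => penalty n a p) '' Set.Icc (0:ℝ) 1) with hS
  have ha01 := ha.1
  have hp0 : penalty n a 0 = a 0 := by
    rcases penalty_zero a with h | h
    · exact h
    · have h1 := (ha01 0).1
      have h2 : 0 ≤ penalty n a 0 :=
        Finset.sum_nonneg fun i _ => mul_nonneg (wt_nonneg n i le_rfl zero_le_one) (abs_nonneg _)
      linarith
  have hp1 : penalty n a 1 = 1 - a (Fin.last n) := by
    rw [penalty_one, abs_of_nonneg]; linarith [(ha01 (Fin.last n)).2]
  have hSpos : 0 < S := by
    by_contra! hneg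
    have h1 := hle 0 ⟨le_rfl, zero_le_one⟩
    have h2 := hle (1/2) ⟨by norm_num, by norm_num⟩
    have h3 := (ha01 0).1
    have h4 : a 0 = 0 := by linarith
    have h5 : wt n (0 : Fin (n+1)) (1/2) * |1/2 - a 0| ≤ penalty n a (1/2) :=
      Finset.single_le_sum (f := fun k : Fin (n+1) => wt n k (1/2) * |1/2 - a k|)
        (fun i _ => mul_nonneg (wt_nonneg n i (by norm_num) (by norm_num)) (abs_nonneg _))
        (Finset.mem_univ 0)
    have h6 : 0 < wt n (0 : Fin (n+1)) (1/2) := wt_pos n _ (by simp) (by norm_num) (by norm_num)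
    rw [h4] at h5
    norm_num at h5 h2
    norm_num at h6
    linarith
  let b : ℝ → Fin (n+1) → ℝ := fun t => pert (pert (pert a k (t^2)) (Fin.last n) (t^3)) 0 (-t^3)
  have hlast : (Fin.last n) ≠ 0 := by
    intro h; have := congrArg Fin.val h; simp at this; omega
  have hbc : Continuous fun z : ℝ × ℝ => penalty n (b z.1) z.2 := by
    simp only [b]; unfold penalty pert; fun_prop
  have hb0 : b 0 = a := by
    ext i; simp [b, pert]
  have loc : ∀ q ∈ Set.Icc (0:ℝ) 1, ∀ᶠ z : ℝ × ℝ in nhds (0, q),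
      (0 < z.1 → z.2 ∈ Set.Icc (0:ℝ) 1 → penalty n (b z.1) z.2 < S) := by
    intro q hq
    by_cases hqS : penalty n a q < S
    · have : ∀ᶠ z : ℝ × ℝ in nhds (0, q), penalty n (b z.1) z.2 < S := by
        refine hbc.continuousAt.eventually_lt continuousAt_const ?_
        simpa [hb0] using hqS
      filter_upwards [this] with z hz _ _ using hz
    have hqS' : penalty n a q = S := le_antisymm (hle q hq) (not_lt.1 hqS)
    have hkq : a k ≤ q := by
      by_contra! h
      exact hcon q hq.1 h hqS'
    have lt_ev : ∀ (f g : ℝ × ℝ → ℝ), Continuous f → Continuous g → f (0,q) < g (0,q) →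
        ∀ᶠ z in nhds ((0:ℝ), q), f z < g z := fun f g hf hg h =>
      hf.continuousAt.eventually_lt hg.continuousAt h
    rcases eq_or_lt_of_le hq.2 with hq1 | hq1
    · -- q = 1
      subst hq1
      have hl : a (Fin.last n) < 1 := by linarith
      have hkl := hk (Fin.last n)
      filter_upwards [lt_ev (fun z => a (Fin.last n) + z.1^2 + z.1^3) (fun z => z.2)
          (by fun_prop) (by fun_prop) (by simpa using hl),
        lt_ev (fun z => (1 - z.2)^n) (fun z => z.2^n)
          (by fun_prop) (by fun_prop) (by simp [hn.ne'])] with z h1 h2 ht hz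
      obtain ⟨t, p⟩ := z
      simp only at h1 h2 ht hz ⊢
      have ht2 : 0 < t^2 := by positivity
      have ht3 : 0 < t^3 := by positivity
      simp only [b]
      rw [penalty_pert, penalty_pert, penalty_pert]
      have s1 : wt n k p * (|p - a k - t^2| - |p - a k|) ≤ 0 := by
        refine mul_nonpos_of_nonneg_of_nonpos (wt_nonneg n k hz.1 hz.2) ?_
        rw [abs_of_nonneg (by linarith), abs_of_nonneg (by linarith)]; linarith
      have s2 : |p - pert a k (t^2) (Fin.last n) - t^3| - |p - pert a k (t^2) (Fin.last n)|
          = - t^3 := by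
        have : pert a k (t^2) (Fin.last n) ≤ a (Fin.last n) + t^2 := by
          unfold pert; split_ifs <;> linarith
        rw [abs_of_nonneg (by linarith), abs_of_nonneg (by linarith)]; linarith
      rw [s2]
      set c := pert (pert a k (t^2)) (Fin.last n) (t^3) 0
      have s3 : |p - c - -t^3| - |p - c| ≤ t^3 := by
        have := abs_add_le (p - c) (t^3)
        rw [abs_of_pos ht3] at this
        rw [sub_neg_eq_add]; linarith
      have w0 : wt n (0 : Fin (n+1)) p = (1-p)^n := by simp [wt]
      have wn : wt n (Fin.last n) p = p^n := by simp [wt]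
      have s3' := mul_le_mul_of_nonneg_left s3 (wt_nonneg n (0 : Fin (n+1)) hz.1 hz.2)
      rw [w0] at s3' ⊢
      rw [wn]
      have := hle p hz
      nlinarith
    rcases eq_or_lt_of_le hq.1 with hq0 | hq0
    · -- q = 0
      subst hq0
      have hak : a k = 0 := le_antisymm hkq (ha01 k).1
      have ha0 : 0 < a 0 := by linarith
      have hk0 : k ≠ 0 := by rintro rfl; linarith
      have hkv : (k : ℕ) ≠ 0 := fun h => hk0 (Fin.ext h)
      filter_upwards [lt_ev (fun z => z.2 + z.1^3) (fun z => a 0)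
          (by fun_prop) (by fun_prop) (by simpa using ha0),
        lt_ev (fun z => (n.choose k : ℝ) * z.1 + z.2^n) (fun z => (1 - z.2)^n)
          (by fun_prop) (by fun_prop) (by simp [hn.ne'])] with z h1 h2 ht hz
      obtain ⟨t, p⟩ := z
      simp only at h1 h2 ht hz ⊢
      have ht2 : 0 < t^2 := by positivity
      have ht3 : 0 < t^3 := by positivity
      simp only [b]
      rw [penalty_pert, penalty_pert, penalty_pert]
      have hw := wt_nonneg n k hz.1 hz.2
      have s1 : wt n k p * (|p - a k - t^2| - |p - a k|) ≤ n.choose k * t * t^3 := by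
        rw [hak, sub_zero, abs_of_nonneg hz.1]
        rcases le_or_gt (t^2) p with h | h
        · have : |p - t^2| - p ≤ 0 := by rw [abs_of_nonneg (by linarith)]; linarith
          exact (mul_nonpos_of_nonneg_of_nonpos hw this).trans (by positivity)
        · have h5 : |p - t^2| - p ≤ t^2 := by
            rw [abs_of_neg (by linarith)]; linarith [hz.1]
          calc _ ≤ wt n k p * t^2 := mul_le_mul_of_nonneg_left h5 hw
            _ ≤ (n.choose k * p) * t^2 := by gcongr; exact wt_le n k hkv hz.1 hz.2
            _ ≤ (n.choose k * t^2) * t^2 := by gcongr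
            _ = _ := by ring
      set d := pert a k (t^2) (Fin.last n)
      have s2 : |p - d - t^3| - |p - d| ≤ t^3 := by
        have := abs_sub (p - d) (t^3)
        rw [abs_of_pos ht3] at this
        linarith
      have hc : pert (pert a k (t^2)) (Fin.last n) (t^3) 0 = a 0 := by
        rw [pert_ne _ hlast.symm, pert_ne _ hk0.symm]
      rw [hc]
      have w0 : wt n (0 : Fin (n+1)) p = (1-p)^n := by simp [wt]
      have wn : wt n (Fin.last n) p = p^n := by simp [wt]
      have s2' := mul_le_mul_of_nonneg_left s2 (wt_nonneg n (Fin.last n) hz.1 hz.2)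
      rw [wn] at s2' ⊢
      rw [w0]
      have := hle p hz
      have s3 : |p - a 0 - -t^3| - |p - a 0| ≤ max (-t^3) (t^3 - 2 * (a 0 - p)) := by
        rw [abs_of_neg (show p - a 0 < 0 by linarith)]
        rcases abs_cases (p - a 0 - -t^3) with h | h
        · exact le_max_of_le_right (by linarith)
        · exact le_max_of_le_left (by linarith)
      rw [max_eq_left (by linarith)] at s3
      have s3' := mul_le_mul_of_nonneg_left s3 (pow_nonneg (by linarith [hz.2] : 0 ≤ 1 - p) n)
      have e := mul_lt_mul_of_pos_right h2 ht3
      nlinarith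
    · -- interior
      have hkq' : a k < q := by
        refine lt_of_le_of_ne hkq fun h => ?_
        refine kink k hk (by linarith) (by linarith) fun p hp => ?_
        rw [h, hqS']; exact hle p hp
      have hwq : 0 < wt n k q := wt_pos n k (by have := k.2; omega) hq0 hq1
      have := wt_cont n k
      filter_upwards [lt_ev (fun z => a k + z.1^2) (fun z => z.2)
          (by fun_prop) (by fun_prop) (by simpa using hkq'),
        lt_ev (fun z => 2 * z.1) (fun z => wt n k z.2)
          (by fun_prop) (by fun_prop) (by simpa using hwq)] with z h1 h2 ht hz
      obtain ⟨t, p⟩ := z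
      simp only at h1 h2 ht hz ⊢
      have ht2 : 0 < t^2 := by positivity
      have ht3 : 0 < t^3 := by positivity
      simp only [b]
      rw [penalty_pert, penalty_pert, penalty_pert]
      have s1 : |p - a k - t^2| - |p - a k| = - t^2 := by
        rw [abs_of_nonneg (by linarith), abs_of_nonneg (by linarith)]; linarith
      rw [s1]
      set d := pert a k (t^2) (Fin.last n)
      have s2 : |p - d - t^3| - |p - d| ≤ t^3 := by
        have := abs_sub (p - d) (t^3)
        rw [abs_of_pos ht3] at this
        linarith
      set c := pert (pert a k (t^2)) (Fin.last n) (t^3) 0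
      have s3 : |p - c - -t^3| - |p - c| ≤ t^3 := by
        have := abs_add_le (p - c) (t^3)
        rw [abs_of_pos ht3] at this
        rw [sub_neg_eq_add]; linarith
      have s2' := mul_le_mul_of_nonneg_left s2 (wt_nonneg n (Fin.last n) hz.1 hz.2)
      have s3' := mul_le_mul_of_nonneg_left s3 (wt_nonneg n (0 : Fin (n+1)) hz.1 hz.2)
      have u2 := mul_le_mul_of_nonneg_right (wt_le_one n (Fin.last n) hz.1 hz.2) ht3.le
      have u3 := mul_le_mul_of_nonneg_right (wt_le_one n 0 hz.1 hz.2) ht3.le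
      have := hle p hz
      have e := mul_lt_mul_of_pos_right h2 ht2
      nlinarith
  have ev := isCompact_Icc.eventually_forall_of_forall_eventually
    (P := fun t p => 0 < t → p ∈ Set.Icc (0:ℝ) 1 → penalty n (b t) p < S) loc
  have ev2 : ∀ᶠ t : ℝ in nhdsWithin 0 (Set.Ioi 0), 0 < t := eventually_mem_nhdsWithin
  obtain ⟨t, h1, h2⟩ := (ev2.and (ev.filter_mono nhdsWithin_le_nhds)).exists
  obtain ⟨p, hp, h3⟩ := hopt (b t)
  linarith [h2 p hp h1 hp]

lemma penalty_rev (n : ℕ) (a : Fin (n+1) → ℝ) (p : ℝ) :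
    penalty n (fun i => 1 - a i.rev) p = penalty n a (1 - p) := by
  rw [penalty_eq, penalty_eq, ← Equiv.sum_comp Fin.revPerm]
  refine Finset.sum_congr rfl fun i _ => ?_
  have hi : (i : ℕ) ≤ n := by have := i.2; omega
  have e1 : ((Fin.revPerm i : Fin (n+1)) : ℕ) = n - i := by simp [Fin.val_rev]
  have e2 : n - (n - (i : ℕ)) = i := by omega
  rw [e1]
  simp only [Fin.revPerm_apply, Fin.rev_rev]
  rw [show p - (1 - a i) = -(1 - p - a i) by ring, abs_neg]
  unfold wt
  rw [e2, Nat.choose_symm hi]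
  ring

lemma image_rev (n : ℕ) (a : Fin (n+1) → ℝ) :
    (fun p => penalty n (fun i => 1 - a i.rev) p) '' Set.Icc (0:ℝ) 1
      = (fun p => penalty n a p) '' Set.Icc (0:ℝ) 1 := by
  ext y
  constructor
  · rintro ⟨p, hp, rfl⟩
    exact ⟨1 - p, ⟨by linarith [hp.2], by linarith [hp.1]⟩, (penalty_rev n a p).symm⟩
  · rintro ⟨p, hp, rfl⟩
    refine ⟨1 - p, ⟨by linarith [hp.2], by linarith [hp.1]⟩, ?_⟩
    simp only [penalty_rev]; congr 1; ring

theorem stmt_4 (n : ℕ) (hn : 0 < n) (a : Fin (n+1) → ℝ) (ha : IsOptimal n a) :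
    (∃ x, 0 ≤ x ∧ x < (⨅ i, a i) ∧
      penalty n a x = sSup ((fun p => penalty n a p) '' Set.Icc (0:ℝ) 1)) ∧
    (∃ y, (⨆ i, a i) < y ∧ y ≤ 1 ∧
      penalty n a y = sSup ((fun p => penalty n a p) '' Set.Icc (0:ℝ) 1)) := by
  refine ⟨half n hn a ha, ?_⟩
  have h : IsOptimal n (fun i => 1 - a i.rev) := by
    refine ⟨fun k => ⟨by linarith [(ha.1 k.rev).2], by linarith [(ha.1 k.rev).1]⟩, fun b hb => ?_⟩
    rw [image_rev]
    exact ha.2 b hb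
  obtain ⟨x, h0, h1, h2⟩ := half n hn _ h
  rw [image_rev, penalty_rev] at h2
  refine ⟨1 - x, ?_, by linarith, h2⟩
  obtain ⟨k, hk⟩ := Finite.exists_max a
  have h3 : (⨆ i, a i) ≤ a k := ciSup_le hk
  have h4 : (⨅ i : Fin (n+1), (1 - a i.rev)) ≤ 1 - a k := by
    have := ciInf_le (Set.finite_range fun i : Fin (n+1) => 1 - a i.rev).bddBelow k.rev
    simpa using this
  linarith
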